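/- Let K ≥ 1 be a real number, let H be a finite group generated by d elements such that every nontrivial complex irreducible representation of H has degree greater than K^21, and let A be an abelian group on which H acts by automorphisms (a ZH-module). Let S be a finite symmetric subset of A with 0 ∈ S, invariant under the action of H, which generates A as a group. Then either |S + S + S| > K·|S|, or the 7d-fold sumset S + S + ⋯ + S contains the subgroup [H,A] of A generated by all elements h·a − a with h ∈ H and a ∈ A. -/

import Mathlib

open scoped Pointwise

/-- Every nonzero subrepresentation contains an irreducible one. -/
theorem Subrepresentation.exists_le_isIrreducible {k G V : Type*} [Field k] [Group G]
    [AddCommGroup V] [Module k V] [FiniteDimensional k V] {ρ : Representation k G V}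
    (W : Subrepresentation ρ) (hW : W.toSubmodule ≠ ⊥) :
    ∃ U : Subrepresentation ρ, U.toSubmodule ≤ W.toSubmodule ∧
      U.toRepresentation.IsIrreducible := by
  obtain ⟨U, ⟨hUW, hU⟩, hmin⟩ := WellFounded.has_min
    (InvImage.wf (fun U : Subrepresentation ρ ↦ U.toSubmodule) (wellFounded_lt))
    {U | U.toSubmodule ≤ W.toSubmodule ∧ U.toSubmodule ≠ ⊥} ⟨W, le_rfl, hW⟩
  refine ⟨U, hUW, ?_⟩
  have key : ∀ X : Subrepresentation U.toRepresentation,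
      X.toSubmodule ≠ ⊥ → X.toSubmodule = ⊤ := by
    intro X hX
    let Y : Subrepresentation ρ := ⟨X.toSubmodule.map U.toSubmodule.subtype, by
      rintro g _ ⟨v, hv, rfl⟩
      exact ⟨_, X.apply_mem_toSubmodule g hv, rfl⟩⟩
    have hYU : Y.toSubmodule ≤ U.toSubmodule := Submodule.map_subtype_le _ _
    have hY : Y.toSubmodule ≠ ⊥ := by
      intro h
      exact hX (Submodule.map_injective_of_injective (Submodule.subtype_injective _)
        (h.trans (Submodule.map_bot _).symm))
    have hYU' : Y.toSubmodule = U.toSubmodule :=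
      hYU.eq_of_not_lt (hmin Y ⟨hYU.trans hUW, hY⟩)
    have := congrArg (Submodule.comap U.toSubmodule.subtype) hYU'
    simpa [Y, Submodule.comap_map_eq_of_injective (Submodule.subtype_injective _)] using this
  have : Nontrivial U.toSubmodule := Submodule.nontrivial_iff_ne_bot.2 hU
  refine { exists_pair_ne := ⟨⊥, ⊤, fun h ↦ ?_⟩, eq_bot_or_eq_top := fun X ↦ ?_ }
  · exact bot_ne_top (α := Submodule k U.toSubmodule) (congrArg toSubmodule h)
  · by_cases hX : X.toSubmodule = ⊥
    · exact Or.inl (toSubmodule_injective hX)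
    · exact Or.inr (toSubmodule_injective (key X hX))

theorem FDRep.simple_of_isIrreducible {k G V : Type} [Field k] [IsAlgClosed k] [CharZero k]
    [Group G] [Finite G] [AddCommGroup V] [Module k V] [FiniteDimensional k V]
    (ρ : Representation k G V) [ρ.IsIrreducible] : CategoryTheory.Simple (FDRep.of ρ) := by
  have : NeZero (Nat.card G : k) := ⟨Nat.cast_ne_zero.2 Nat.card_pos.ne'⟩
  rw [FDRep.simple_iff_end_is_rank_one, ← Representation.IsIrreducible.finrank_intertwiningMap_self ρ]
  exact ((FDRep.forget₂HomLinearEquiv (FDRep.of ρ) (FDRep.of ρ)).symm.trans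
    (Rep.homLinearEquiv _ _)).finrank_eq

/-- The frame operator of a finite family `k` has an eigenvalue `c` which bounds its quadratic form
and whose multiplicity times `c` is at most `∑ x, ‖k x‖ ^ 2`. -/
theorem exists_eigenvalue_bound {ι E : Type*} [Fintype ι] [NormedAddCommGroup E]
    [InnerProductSpace ℂ E] [FiniteDimensional ℂ E] [Nontrivial E] (k : ι → E) (T : E →ₗ[ℂ] E)
    (hT : ∀ f, T f = ∑ x, inner ℂ (k x) f • k x) :
    ∃ c : ℝ, (∀ f, ∑ x, ‖inner ℂ (k x) f‖ ^ 2 ≤ c * ‖f‖ ^ 2) ∧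
      Module.End.HasEigenvalue T c ∧
      Module.finrank ℂ (Module.End.eigenspace T c) * c ≤ ∑ x, ‖k x‖ ^ 2 := by
  have hinner : ∀ f g, inner ℂ (T f) g = ∑ x, inner ℂ f (k x) * inner ℂ (k x) g := by
    intro f g
    simp [hT, mul_comm]
  have hsymm : T.IsSymmetric := by
    intro f g
    rw [hinner, ← inner_conj_symm, hinner, map_sum]
    refine Finset.sum_congr rfl fun x _ ↦ ?_
    simp [mul_comm]
  have hself : ∀ f, inner ℂ (T f) f = ((∑ x, ‖inner ℂ (k x) f‖ ^ 2 : ℝ) : ℂ) := by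
    intro f
    rw [hinner, Complex.ofReal_sum]
    refine Finset.sum_congr rfl fun x _ ↦ ?_
    rw [← inner_conj_symm, Complex.conj_mul', Complex.ofReal_pow]
  refine ⟨_, fun f ↦ ?_, hsymm.hasEigenvalue_iSup_of_finiteDimensional, ?_⟩
  · rcases eq_or_ne f 0 with rfl | hf
    · simp
    have hf' : 0 < ‖f‖ ^ 2 := by positivity
    have hre : RCLike.re (inner ℂ (T f) f) = ∑ x, ‖inner ℂ (k x) f‖ ^ 2 := by
      rw [hself]
      exact Complex.ofReal_re _
    rw [← div_le_iff₀ hf', ← hre]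
    refine le_ciSup (f := fun x : {x : E // x ≠ 0} ↦
      RCLike.re (inner ℂ (T x) (x : E)) / ‖(x : E)‖ ^ 2) ⟨‖LinearMap.toContinuousLinearMap T‖, ?_⟩
      ⟨f, hf⟩
    rintro _ ⟨⟨x, hx⟩, rfl⟩
    have hx' : 0 < ‖x‖ ^ 2 := by positivity
    rw [div_le_iff₀ hx']
    calc RCLike.re (inner ℂ (T x) x) ≤ ‖T x‖ * ‖x‖ := re_inner_le_norm _ _
      _ ≤ ‖LinearMap.toContinuousLinearMap T‖ * ‖x‖ * ‖x‖ := by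
        gcongr
        exact (LinearMap.toContinuousLinearMap T).le_opNorm x
      _ = _ := by ring
  · set c := (⨆ x : { x : E // x ≠ 0 }, RCLike.re (inner ℂ (T x) x) / ‖(x : E)‖ ^ 2 : ℝ)
    let b := stdOrthonormalBasis ℂ (Module.End.eigenspace T (c : ℂ))
    have hb : Orthonormal ℂ (fun i ↦ (b i : E)) :=
      b.orthonormal.comp_linearIsometry (Submodule.subtypeₗᵢ _)
    have h1 : ∀ i, ∑ x, ‖inner ℂ (k x) (b i : E)‖ ^ 2 = c := by
      intro i
      have := hself (b i : E)
      rw [Module.End.mem_eigenspace_iff.1 (b i).2, inner_smul_left, inner_self_eq_norm_sq_to_K,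
        hb.1 i, Complex.conj_ofReal] at this
      simpa using (Complex.ofReal_injective (by simpa using this)).symm
    calc _ = ∑ i, ∑ x, ‖inner ℂ (k x) (b i : E)‖ ^ 2 := by simp [h1]
      _ = ∑ x, ∑ i, ‖inner ℂ (b i : E) (k x)‖ ^ 2 := by
        rw [Finset.sum_comm]
        simp only [norm_inner_symm]
      _ ≤ _ := Finset.sum_le_sum fun x _ ↦ hb.sum_inner_products_le (s := Finset.univ) (x := k x)

/-- The right regular representation on functions on a finite group. -/
noncomputable def rightTranslation (H : Type*) [Group H] [Fintype H] :
    Representation ℂ H (EuclideanSpace ℂ H) where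
  toFun g :=
    { toFun := fun f ↦ WithLp.toLp 2 fun x ↦ f (x * g)
      map_add' := fun _ _ ↦ rfl
      map_smul' := fun _ _ ↦ rfl }
  map_one' := by ext; simp
  map_mul' g h := by
    ext f x
    exact congrArg f.ofLp (mul_assoc x g h).symm

@[simp]
theorem rightTranslation_apply {H : Type*} [Group H] [Fintype H] (g : H) (f : EuclideanSpace ℂ H)
    (x : H) : rightTranslation H g f x = f (x * g) := rfl

theorem inner_rightTranslation {H : Type*} [Group H] [Fintype H] (g : H)
    (u f : EuclideanSpace ℂ H) :
    inner ℂ u (rightTranslation H g f) = inner ℂ (rightTranslation H g⁻¹ u) f := by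
  simp only [PiLp.inner_apply, rightTranslation_apply]
  exact Fintype.sum_equiv (Equiv.mulRight g) _ _ fun x ↦ by simp

/-- Gowers' trick: if nontrivial irreducible representations of `H` have degree at least `m` and
`m * |P| ^ 3 > |H| ^ 3`, then `P * g * P` meets `P` for every `g`. -/
theorem card_pow_three_le_of_forall_notMem {H : Type} [Group H] [Fintype H] (m : ℝ)
    (hdeg : ∀ V : FDRep ℂ H, CategoryTheory.Simple V → (∃ h : H, V.ρ h ≠ 1) →
      m ≤ (Module.finrank ℂ V : ℝ))
    (P : Finset H) (g : H) (hP : ∀ a ∈ P, ∀ b ∈ P, a * g * b ∉ P) :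
    m * P.card ^ 3 ≤ Fintype.card H ^ 3 := by
  classical
  rcases P.eq_empty_or_nonempty with rfl | hne
  · simp
  have hP0 : (0 : ℝ) < P.card := by exact_mod_cast hne.card_pos
  have hH0 : (0 : ℝ) < Fintype.card H := by exact_mod_cast Fintype.card_pos
  set p : ℝ := P.card / Fintype.card H with hp
  have hpH : p * Fintype.card H = P.card := by
    rw [hp, div_mul_cancel₀ _ hH0.ne']
  have hp0 : 0 < p := by positivity
  let φ : H → ℝ := fun x ↦ (if x ∈ P then 1 else 0) - p
  let k : H → EuclideanSpace ℂ H := fun x ↦ WithLp.toLp 2 fun y ↦ (φ (y * x⁻¹) : ℂ)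
  have hφ : ∑ y, φ y = 0 := by
    simp only [φ, Finset.sum_sub_distrib, Finset.sum_boole, Finset.sum_const, Finset.card_univ]
    rw [nsmul_eq_mul, mul_comm, hpH]
    simp
  have hk_sum : ∀ x, ∑ y, k x y = 0 := by
    intro x
    rw [Fintype.sum_equiv (Equiv.mulRight x⁻¹) (k x) (fun y ↦ (φ y : ℂ)) fun y ↦ rfl,
      ← Complex.ofReal_sum, hφ, Complex.ofReal_zero]
  have hk_norm : ∀ x, ‖k x‖ ^ 2 ≤ P.card := by
    intro x
    rw [EuclideanSpace.norm_sq_eq,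
      Fintype.sum_equiv (Equiv.mulRight x⁻¹) (fun y ↦ ‖k x y‖ ^ 2) (fun y ↦ φ y ^ 2)
        fun y ↦ by simp [k]]
    have : ∀ y, φ y ^ 2 = (if y ∈ P then 1 else 0) - p * φ y - p * (if y ∈ P then 1 else 0) := by
      intro y
      by_cases hy : y ∈ P <;> simp [φ, hy] <;> ring
    simp only [this, Finset.sum_sub_distrib, ← Finset.mul_sum, hφ, Finset.sum_boole]
    simp
    positivity
  have hk_trans : ∀ g x, rightTranslation H g (k x) = k (x * g⁻¹) := by
    intro g x
    ext y
    simp [k, mul_assoc]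
  let T : EuclideanSpace ℂ H →ₗ[ℂ] EuclideanSpace ℂ H :=
    ∑ x, (innerₛₗ ℂ (k x)).smulRight (k x)
  have hT : ∀ f, T f = ∑ x, inner ℂ (k x) f • k x := by
    intro f
    simp [T]
  have hTcomm : ∀ g f, T (rightTranslation H g f) = rightTranslation H g (T f) := by
    intro g f
    rw [hT, hT, map_sum]
    simp only [map_smul, inner_rightTranslation, hk_trans, inv_inv]
    exact Fintype.sum_equiv (Equiv.mulRight g) _ _ fun x ↦ by simp
  obtain ⟨c, hbound, heig, hdim⟩ := exists_eigenvalue_bound k T hT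
  have hlower : p ^ 2 * P.card ^ 2 ≤ c := by
    let f : EuclideanSpace ℂ H := WithLp.toLp 2 fun y ↦ if y ∈ P then 1 else 0
    have hf : ‖f‖ ^ 2 = P.card := by
      rw [EuclideanSpace.norm_sq_eq]
      simp [f, apply_ite, ite_pow]
    have hkf : ∀ b ∈ P, ‖inner ℂ (k (g * b)) f‖ ^ 2 = p ^ 2 * P.card ^ 2 := by
      intro b hb
      have : inner ℂ (k (g * b)) f = ((-(p * P.card) : ℝ) : ℂ) := by
        have hterm : ∀ y ∈ P, φ (y * (g * b)⁻¹) = -p := by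
          intro y hy
          have : y * (g * b)⁻¹ ∉ P := fun h ↦ hP _ h b hb (by simpa [mul_assoc] using hy)
          simp only [φ, if_neg this, zero_sub]
        simp only [PiLp.inner_apply, f, k, RCLike.inner_apply, Complex.conj_ofReal, ite_mul,
          one_mul, zero_mul, Finset.sum_ite_mem, Finset.univ_inter]
        rw [← Complex.ofReal_sum, Finset.sum_congr rfl hterm, Finset.sum_const, nsmul_eq_mul]
        congr 1
        ring
      rw [this, Complex.norm_real, Real.norm_eq_abs, sq_abs]
      ring
    have h1 := hbound f
    rw [hf] at h1
    have h2 : P.card * (p ^ 2 * P.card ^ 2) ≤ ∑ x, ‖inner ℂ (k x) f‖ ^ 2 := by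
      calc (P.card * (p ^ 2 * P.card ^ 2) : ℝ)
          = ∑ b ∈ P, ‖inner ℂ (k (g * b)) f‖ ^ 2 := by
            rw [Finset.sum_congr rfl hkf, Finset.sum_const, nsmul_eq_mul]
        _ = ∑ x ∈ P.image (g * ·), ‖inner ℂ (k x) f‖ ^ 2 := by
            rw [Finset.sum_image (by simp)]
        _ ≤ _ := Finset.sum_le_sum_of_subset_of_nonneg (Finset.subset_univ _)
            fun _ _ _ ↦ by positivity
    exact le_of_mul_le_mul_left (by linarith) hP0
  have hc : 0 < c := lt_of_lt_of_le (by positivity) hlower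
  have hmdim : m ≤ Module.finrank ℂ (Module.End.eigenspace T (c : ℂ)) := by
    let W : Subrepresentation (rightTranslation H) :=
      ⟨Module.End.eigenspace T (c : ℂ), fun g v hv ↦ by
        rw [Module.End.mem_eigenspace_iff] at hv ⊢
        rw [hTcomm, hv, map_smul]⟩
    obtain ⟨U, hUW, hU⟩ := W.exists_le_isIrreducible heig
    have hmean : ∀ f ∈ U.toSubmodule, ∑ y, f y = 0 := by
      intro f hf
      have hfT : T f = (c : ℂ) • f := Module.End.mem_eigenspace_iff.1 (hUW hf)
      have hsum : ∑ y, (T f) y = 0 := by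
        rw [hT]
        simp only [WithLp.ofLp_sum, Finset.sum_apply, PiLp.smul_apply, smul_eq_mul]
        rw [Finset.sum_comm]
        simp [← Finset.mul_sum, hk_sum]
      rw [hfT] at hsum
      simpa [← Finset.mul_sum, hc.ne'] using hsum
    have hnontriv : ∃ h : H, (FDRep.of U.toRepresentation).ρ h ≠ 1 := by
      by_contra! htriv
      have hbot : U.toSubmodule = ⊥ := by
        rw [Submodule.eq_bot_iff]
        intro f hf
        have hconst : ∀ y, f y = f 1 := by
          intro y
          have h1 : U.toRepresentation y ⟨f, hf⟩ = ⟨f, hf⟩ := by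
            have := LinearMap.congr_fun (htriv y) (⟨f, hf⟩ : U.toSubmodule)
            exact this
          have h2 : rightTranslation H y f = f := congrArg Subtype.val h1
          simpa using congrArg (fun u : EuclideanSpace ℂ H ↦ u 1) h2
        have h0 := hmean f hf
        simp only [hconst, Finset.sum_const, Finset.card_univ, nsmul_eq_mul, mul_eq_zero,
          Nat.cast_eq_zero, Fintype.card_ne_zero, false_or] at h0
        ext y
        rw [hconst, h0]
        rfl
      exact hU.toNontrivial.exists_pair_ne.elim fun X ⟨Y, hXY⟩ ↦ hXY <| by
        apply Subrepresentation.toSubmodule_injective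
        have : Subsingleton U.toSubmodule := by rw [hbot]; infer_instance
        exact Subsingleton.elim _ _
    calc m ≤ Module.finrank ℂ U.toSubmodule :=
          hdeg _ (FDRep.simple_of_isIrreducible U.toRepresentation) hnontriv
      _ ≤ _ := by exact_mod_cast Submodule.finrank_mono hUW
  have hfinal : m * (p ^ 2 * P.card ^ 2) ≤ Fintype.card H * P.card := by
    calc m * (p ^ 2 * P.card ^ 2) ≤ Module.finrank ℂ (Module.End.eigenspace T (c : ℂ)) * c := by
          gcongr
      _ ≤ ∑ x, ‖k x‖ ^ 2 := hdim
      _ ≤ ∑ _x : H, (P.card : ℝ) := Finset.sum_le_sum fun x _ ↦ hk_norm x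
      _ = _ := by simp
  refine le_of_mul_le_mul_right ?_ hP0
  calc m * (P.card : ℝ) ^ 3 * P.card
      = m * ((p * Fintype.card H) ^ 2 * P.card ^ 2) := by rw [hpH]; ring
    _ = m * (p ^ 2 * P.card ^ 2) * Fintype.card H ^ 2 := by ring
    _ ≤ Fintype.card H * P.card * Fintype.card H ^ 2 := by gcongr
    _ = Fintype.card H ^ 3 * P.card := by ring

theorem exists_card_translates {H A : Type*} [Group H] [Fintype H] [AddCommGroup A] [DecidableEq A]
    [DistribMulAction H A] (S Q : Finset A) (a : A) (hS : S.Nonempty) (C : ℝ)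
    (hQ : ∀ h : H, ∀ s ∈ S, h • a + s ∈ Q) (hC : (Q.card : ℝ) ≤ C * S.card) :
    ∃ z, (Fintype.card H : ℝ) ≤ C * (Finset.univ.filter fun h : H ↦ z - h • a ∈ S).card := by
  by_contra! hcon
  have hcount : ∑ z ∈ Q, (Finset.univ.filter fun h : H ↦ z - h • a ∈ S).card =
      Fintype.card H * S.card := by
    simp only [Finset.card_filter]
    rw [Finset.sum_comm]
    simp only [← Finset.card_filter]
    rw [Finset.sum_congr rfl (g := fun _ ↦ S.card), Finset.sum_const, Finset.card_univ,
      smul_eq_mul]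
    intro h _
    refine Finset.card_bij' (fun z _ ↦ z - h • a) (fun s _ ↦ h • a + s) ?_ ?_ ?_ ?_
    · simp
    · intro s hs
      simpa [hs] using hQ h s hs
    · simp
    · simp
  have hQne : Q.Nonempty := by
    obtain ⟨s, hs⟩ := hS
    exact ⟨_, hQ 1 s hs⟩
  have hS0 : (0 : ℝ) < S.card := by exact_mod_cast hS.card_pos
  have hQ0 : (0 : ℝ) < Q.card := by exact_mod_cast hQne.card_pos
  have hC0 : 0 < C := pos_of_mul_pos_left (hQ0.trans_le hC) hS0.le
  have h1 : C * (Fintype.card H * S.card : ℝ) < Q.card * Fintype.card H := by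
    rw [← Nat.cast_mul, ← hcount, Nat.cast_sum, Finset.mul_sum, ← nsmul_eq_mul]
    rw [← Finset.sum_const]
    exact Finset.sum_lt_sum_of_nonempty hQne fun z _ ↦ hcon z
  have h2 : (Q.card : ℝ) * Fintype.card H ≤ C * S.card * Fintype.card H := by gcongr
  linarith

theorem smul_sub_mem_of_forall_card_le {H A : Type*} [Group H] [Fintype H] [AddCommGroup A]
    [DecidableEq A] [DistribMulAction H A] (K : ℝ) (S : Finset A)
    (hzero : (0 : A) ∈ S) (hsym : -S = S) (hinv : ∀ (h : H), ∀ s ∈ S, h • s ∈ S)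
    (hgenA : AddSubgroup.closure (S : Set A) = ⊤) (hS : ((3 • S).card : ℝ) ≤ K * S.card)
    (hmix : ∀ P : Finset H, (Fintype.card H : ℝ) ≤ K ^ 7 * P.card → ∀ g : H,
      ∃ a ∈ P, ∃ b ∈ P, a * g * b ∈ P) (a : A) (h : H) :
    h • a - a ∈ 7 • S := by
  have hneg : ∀ s ∈ S, -s ∈ S := fun s hs ↦ by
    rw [← hsym]; exact Finset.neg_mem_neg hs
  have hinv' : ∀ (n : ℕ) (h : H), ∀ s ∈ n • S, h • s ∈ n • S := by
    intro n h
    induction n with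
    | zero => simp
    | succ n ih =>
      intro s hs
      rw [succ_nsmul, Finset.mem_add] at hs ⊢
      obtain ⟨x, hx, y, hy, rfl⟩ := hs
      exact ⟨_, ih x hx, _, hinv h y hy, (smul_add _ _ _).symm⟩
  have hstep : ∀ b s, s ∈ S → (∀ h : H, h • b - b ∈ 7 • S) →
      ∀ h : H, h • (b + s) - (b + s) ∈ 7 • S := by
    intro b s hs hb
    obtain ⟨z, hz⟩ := exists_card_translates (H := H) S (b +ᵥ (9 • S)) (b + s) ⟨0, hzero⟩ (K ^ 7)
      (by
        intro h t ht
        rw [Finset.mem_vadd_finset]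
        refine ⟨(h • b - b) + h • s + t, ?_, ?_⟩
        · rw [succ_nsmul, succ_nsmul]
          exact Finset.add_mem_add (Finset.add_mem_add (hb h) (hinv h s hs)) ht
        · rw [smul_add, vadd_eq_add]; abel)
      (by
        rw [Finset.card_vadd_finset]
        exact Finset.small_nsmul_of_small_tripling (m := 9) (by norm_num) hS hsym)
    set c := b + s
    have hdiff : ∀ p q : H, z - p • c ∈ S → z - q • c ∈ S → p • c - q • c ∈ 2 • S := by
      intro p q hp hq
      rw [two_nsmul, ← sub_add_sub_cancel _ z, ← neg_sub z (p • c)]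
      exact Finset.add_mem_add (hneg _ hp) hq
    intro h
    obtain ⟨p₀, hp₀, -⟩ := hmix _ hz 1
    obtain ⟨p, hp, q, hq, hpq⟩ := hmix _ hz (h * p₀⁻¹)
    simp only [Finset.mem_filter, Finset.mem_univ, true_and] at hp₀ hp hq hpq
    have h1 := hinv' 2 (h * p₀⁻¹) _ (hdiff p₀ q hp₀ hq)
    have h2 := hinv' 2 p⁻¹ _ (hdiff _ p hpq hp)
    have h4 : h • c - c ∈ 4 • S := by
      have h3 := Finset.add_mem_add h1 h2
      rw [← add_nsmul] at h3
      convert h3 using 1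
      simp only [smul_sub, smul_smul, mul_assoc, inv_mul_cancel, inv_mul_cancel_left, mul_one,
        one_smul]
      abel
    exact Finset.nsmul_subset_nsmul_right hzero (by norm_num : 4 ≤ 7) h4
  have hmem : a ∈ AddSubgroup.closure (S : Set A) := hgenA ▸ AddSubgroup.mem_top a
  induction hmem using AddSubgroup.closure_induction_right generalizing h with
  | zero =>
    simpa using Finset.nsmul_subset_nsmul_right hzero (Nat.zero_le 7)
      (by simp : (0 : A) ∈ 0 • S)
  | add_right x _ y hy ih => exact hstep x y hy ih h
  | add_neg_cancel x _ y hy ih => exact hstep x (-y) (hneg y hy) ih h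

theorem closure_smul_sub_subset {H A : Type*} [Group H] [AddCommGroup A]
    [DistribMulAction H A] (T : Finset H) (hT : Subgroup.closure (T : Set H) = ⊤) (B : Set A)
    (hB : ∀ (h : H) (a : A), h • a - a ∈ B) :
    (AddSubgroup.closure {x : A | ∃ (h : H) (a : A), x = h • a - a} : Set A) ⊆ T.card • B := by
  let φ : (H → A) →+ A :=
    { toFun := fun f ↦ ∑ t ∈ T, (t • f t - f t)
      map_zero' := by simp
      map_add' := fun f g ↦ by
        rw [← Finset.sum_add_distrib]
        refine Finset.sum_congr rfl fun t _ ↦ ?_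
        simp only [Pi.add_apply, smul_add]
        abel }
  have hle : AddSubgroup.closure {x : A | ∃ (h : H) (a : A), x = h • a - a} ≤ φ.range := by
    rw [AddSubgroup.closure_le]
    rintro _ ⟨h, a, rfl⟩
    have hh : h ∈ Subgroup.closure (T : Set H) := hT ▸ Subgroup.mem_top h
    induction hh using Subgroup.closure_induction generalizing a with
    | mem t ht =>
      classical
      refine ⟨Pi.single t a, ?_⟩
      change ∑ u ∈ T, (u • (Pi.single t a : H → A) u - (Pi.single t a : H → A) u) = _
      rw [Finset.sum_eq_single_of_mem t ht]
      · simp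
      · intro u _ hu
        simp [hu]
    | one =>
      rw [one_smul, sub_self]
      exact zero_mem φ.range
    | mul g h _ _ ihg ihh =>
      rw [← sub_add_sub_cancel _ (h • a) a, mul_smul]
      exact add_mem (ihg _) (ihh a)
    | inv g _ ih =>
      have := neg_mem (ih (g⁻¹ • a))
      simpa using this
  intro x hx
  obtain ⟨f, rfl⟩ := hle hx
  rw [← Finset.sum_const]
  exact Set.finsetSum_mem_finsetSum _ _ _ fun t _ ↦ hB t (f t)

/-- **Conjugation trick** (Pyber–Szabó): let `K ≥ 1`, let `H` be a finite
`d`-generated group all of whose nontrivial complex irreducible representations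
have degree `> K^21`, and let `A` be a `ℤH`-module (an abelian group with an
`H`-action by automorphisms). If `S ⊆ A` is a finite symmetric `H`-invariant
generating set containing `0`, then `|S + S + S| > K·|S|`, or the `7d`-fold
sumset of `S` contains the submodule `[H,A]` generated by all `h • a - a`. -/
theorem conjugation_trick (K : ℝ) (hK : 1 ≤ K) (d : ℕ)
    (H : Type) [Group H] [Finite H]
    (hgen : ∃ T : Finset H, T.card ≤ d ∧ Subgroup.closure (T : Set H) = ⊤)
    (hdeg : ∀ V : FDRep ℂ H, CategoryTheory.Simple V → (∃ h : H, V.ρ h ≠ 1) →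
      K ^ 21 < (Module.finrank ℂ V : ℝ))
    (A : Type) [AddCommGroup A] [DistribMulAction H A]
    (S : Set A) (hfin : S.Finite) (hzero : (0 : A) ∈ S) (hsym : S = -S)
    (hinv : ∀ h : H, h • S = S)
    (hgenA : AddSubgroup.closure S = ⊤) :
    K * (Nat.card ↥S : ℝ) < (Nat.card ↥(S + S + S) : ℝ) ∨
      ((AddSubgroup.closure {x : A | ∃ (h : H) (a : A), x = h • a - a} : AddSubgroup A) :
          Set A) ⊆ (List.replicate (7 * d) S).sum := by
  classical
  have := Fintype.ofFinite H
  obtain ⟨T, hTd, hT⟩ := hgen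
  rw [or_iff_not_imp_left, not_lt]
  intro hK3
  obtain ⟨S, rfl⟩ := hfin.exists_finset_coe
  have hS3 : ((3 • S).card : ℝ) ≤ K * S.card := by
    have h3 : (S : Set A) + S + S = ((3 • S : Finset A) : Set A) := by
      rw [Finset.coe_nsmul, succ_nsmul, two_nsmul]
    rw [h3] at hK3
    rwa [Nat.card_coe_set_eq, Nat.card_coe_set_eq, Set.ncard_coe_finset, Set.ncard_coe_finset]
      at hK3
  have hmix : ∀ P : Finset H, (Fintype.card H : ℝ) ≤ K ^ 7 * P.card → ∀ g : H,
      ∃ a ∈ P, ∃ b ∈ P, a * g * b ∈ P := by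
    intro P hP g
    by_contra! hcon
    have hH0 : (0 : ℝ) < Fintype.card H := by exact_mod_cast Fintype.card_pos
    have hP0 : (0 : ℝ) < P.card := by
      by_contra! h
      have : K ^ 7 * (P.card : ℝ) ≤ 0 := mul_nonpos_of_nonneg_of_nonpos (by positivity) h
      linarith
    have hle := card_pow_three_le_of_forall_notMem (⌊K ^ 21⌋₊ + 1 : ℝ) (fun V hV hV' ↦ by
      exact_mod_cast (Nat.floor_lt (by positivity)).2 (hdeg V hV hV')) P g hcon
    have hlt : K ^ 21 * (P.card : ℝ) ^ 3 < (⌊K ^ 21⌋₊ + 1) * (P.card : ℝ) ^ 3 := by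
      exact mul_lt_mul_of_pos_right (Nat.lt_floor_add_one _) (pow_pos hP0 3)
    have hcube : (Fintype.card H : ℝ) ^ 3 ≤ (K ^ 7 * P.card) ^ 3 := by gcongr
    linarith [mul_pow (K ^ 7) (P.card : ℝ) 3, pow_mul K 7 3]
  have h7 : ∀ (h : H) (a : A), h • a - a ∈ ((7 • S : Finset A) : Set A) := fun h a ↦
    smul_sub_mem_of_forall_card_le K S (by simpa using hzero)
      (by exact_mod_cast hsym.symm) (fun h s hs ↦ by
        have := Set.smul_mem_smul_set (a := h) (Finset.mem_coe.2 hs)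
        rwa [hinv h] at this) hgenA hS3 hmix a h
  refine (closure_smul_sub_subset T hT _ h7).trans ?_
  rw [List.sum_replicate, Finset.coe_nsmul, ← mul_nsmul]
  exact Set.nsmul_subset_nsmul_right hzero (Nat.mul_le_mul_left 7 hTd)
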